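/- Let K be an algebraically closed field of characteristic zero, k ≥ 1, and let H ∈ K[y,z] be a linear combination of at most two (2k+2)-nd powers of pairwise linearly independent linear forms in y and z. Set Fα := x·y^{k-1}·z^{k+2} + y^{2k}·z² − H ∈ K[x,y,z]. Then the K-dimension of the span of all (k+1)-st order partial derivatives of Fα is at least 2k+1 (in particular, strictly greater than 2k). -/

import Mathlib

open MvPolynomial

/-- The span of all `n`-th order partial derivatives of a ternary polynomial `F`
(with variables `x = X 0`, `y = X 1`, `z = X 2`). -/
noncomputable def derivSpan (K : Type*) [CommSemiring K] (n : ℕ)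
    (F : MvPolynomial (Fin 3) K) : Submodule K (MvPolynomial (Fin 3) K) :=
  Submodule.span K {G | ∃ i j l : ℕ, i + j + l = n ∧
    G = (⇑(pderiv (0 : Fin 3)))^[i] ((⇑(pderiv (1 : Fin 3)))^[j]
          ((⇑(pderiv (2 : Fin 3)))^[l] F))}

/-- The exponent vector of the monomial `x ^ i * y ^ j * z ^ l`. -/
noncomputable def exponent (i j l : ℕ) : Fin 3 →₀ ℕ :=
  Finsupp.single 0 i + Finsupp.single 1 j + Finsupp.single 2 l

/-- The mixed partial derivative of order `(i, j, l)` of a ternary polynomial. -/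
noncomputable def iterPderiv (K : Type*) [CommSemiring K] (i j l : ℕ)
    (F : MvPolynomial (Fin 3) K) : MvPolynomial (Fin 3) K :=
  (⇑(pderiv (0 : Fin 3)))^[i] ((⇑(pderiv (1 : Fin 3)))^[j] ((⇑(pderiv (2 : Fin 3)))^[l] F))

theorem exponent_inj {i j l i' j' l' : ℕ} :
    exponent i j l = exponent i' j' l' ↔ i = i' ∧ j = j' ∧ l = l' := by
  refine ⟨fun h ↦ ⟨?_, ?_, ?_⟩, by rintro ⟨rfl, rfl, rfl⟩; rfl⟩
  · simpa [exponent] using DFunLike.congr_fun h 0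
  · simpa [exponent] using DFunLike.congr_fun h 1
  · simpa [exponent] using DFunLike.congr_fun h 2

theorem X_pow_mul_X_pow_mul_X_pow {K : Type*} [CommSemiring K] (i j l : ℕ) :
    (X 0 ^ i * X 1 ^ j * X 2 ^ l : MvPolynomial (Fin 3) K) = monomial (exponent i j l) 1 := by
  simp [X_pow_eq_monomial, monomial_mul, exponent]

theorem coeff_iterate_pderiv_eq_zero_iff {σ K : Type*} [Field K] [CharZero K] (i : σ) (n : ℕ)
    (m : σ →₀ ℕ) (F : MvPolynomial σ K) :
    coeff m ((⇑(pderiv i))^[n] F) = 0 ↔ coeff (m + Finsupp.single i n) F = 0 := by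
  induction n generalizing F with
  | zero => simp
  | succ n ih =>
    rw [Function.iterate_succ_apply, ih, coeff_pderiv, add_assoc, ← Finsupp.single_add]
    simp only [mul_eq_zero, or_iff_left_iff_imp]
    norm_cast
    simp

theorem coeff_iterPderiv_eq_zero_iff {K : Type*} [Field K] [CharZero K] (i j l a b c : ℕ)
    (F : MvPolynomial (Fin 3) K) :
    coeff (exponent a b c) (iterPderiv K i j l F) = 0 ↔
      coeff (exponent (a + i) (b + j) (c + l)) F = 0 := by
  rw [iterPderiv, coeff_iterate_pderiv_eq_zero_iff, coeff_iterate_pderiv_eq_zero_iff,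
    coeff_iterate_pderiv_eq_zero_iff]
  simp only [exponent, Finsupp.single_add]
  congr! 2
  abel

theorem iterPderiv_mem_derivSpan {K : Type*} [CommSemiring K] {i j l n : ℕ}
    (h : i + j + l = n) (F : MvPolynomial (Fin 3) K) : iterPderiv K i j l F ∈ derivSpan K n F :=
  Submodule.subset_span ⟨i, j, l, h, rfl⟩

theorem finite_derivSpan {K : Type*} [Field K] (n : ℕ) (F : MvPolynomial (Fin 3) K) :
    Module.Finite K (derivSpan K n F) := by
  refine FiniteDimensional.span_of_finite K (Set.Finite.subset
    (Set.finite_range fun t : Fin (n + 1) × Fin (n + 1) × Fin (n + 1) ↦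
      iterPderiv K t.1 t.2.1 t.2.2 F) ?_)
  rintro _ ⟨i, j, l, h, rfl⟩
  exact ⟨(⟨i, by lia⟩, ⟨j, by lia⟩, ⟨l, by lia⟩), rfl⟩

/-- A family admitting functionals that are triangular with respect to a rank function, with
nonzero diagonal, is linearly independent. -/
theorem linearIndependent_of_triangular {ι K M : Type*} [Finite ι] [Field K] [AddCommGroup M]
    [Module K M] (v : ι → M) (f : ι → M →ₗ[K] K) (r : ι → ℕ) (hdiag : ∀ i, f i (v i) ≠ 0)
    (htri : ∀ i j, i ≠ j → r i ≤ r j → f i (v j) = 0) : LinearIndependent K v := by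
  have := Fintype.ofFinite ι
  rw [Fintype.linearIndependent_iff]
  intro g hg
  suffices ∀ n i, r i = n → g i = 0 from fun i ↦ this _ i rfl
  intro n
  induction n using Nat.strong_induction_on with
  | _ n ih =>
    rintro i rfl
    have hsum := congrArg (f i) hg
    rw [map_sum, map_zero, Finset.sum_eq_single i] at hsum
    · simpa [hdiag i] using hsum
    · intro j _ hj
      rcases lt_or_ge (r j) (r i) with h | h
      · simp [ih _ h j rfl]
      · simp [htri i j hj.symm h]
    · simp

theorem coeff_eq_zero_of_pderiv_zero {K : Type*} [Field K] [CharZero K]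
    {F : MvPolynomial (Fin 3) K} (hF : pderiv 0 F = 0) (i j l : ℕ) :
    coeff (exponent (i + 1) j l) F = 0 := by
  have h := coeff_iterPderiv_eq_zero_iff 1 0 0 i j l F
  simpa [iterPderiv, hF] using h

/-- A linear form in `x, y, z` not depending on `x` is a combination of `y` and `z`. -/
theorem exists_eq_of_isHomogeneous_one {K : Type*} [Field K] [CharZero K]
    {L : MvPolynomial (Fin 3) K} (hL : L.IsHomogeneous 1) (h0 : pderiv 0 L = 0) :
    ∃ a b : K, L = C a * X 1 + C b * X 2 := by
  have hx : coeff (Finsupp.single 0 1) L = 0 := by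
    simpa [exponent] using coeff_eq_zero_of_pderiv_zero h0 0 0 0
  refine ⟨coeff (Finsupp.single 1 1) L, coeff (Finsupp.single 2 1) L, ?_⟩
  have hM : (C (coeff (Finsupp.single 1 1) L) * X 1 + C (coeff (Finsupp.single 2 1) L) * X 2 :
      MvPolynomial (Fin 3) K).IsHomogeneous 1 :=
    ((isHomogeneous_X K 1).C_mul _).add ((isHomogeneous_X K 2).C_mul _)
  ext m
  by_cases hm : m.degree = 1
  · obtain ⟨i, rfl⟩ := (Finsupp.sum_eq_one_iff m).1 hm
    fin_cases i <;> simp [coeff_X, hx, Finsupp.single_left_inj]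
  · rw [hL.coeff_eq_zero hm, hM.coeff_eq_zero hm]

theorem coeff_linear_form_pow {K : Type*} [Field K] (a b : K) (p q : ℕ) :
    coeff (exponent 0 p q) ((C a * X 1 + C b * X 2 : MvPolynomial (Fin 3) K) ^ (p + q)) =
      a ^ p * b ^ q * (p + q).choose p := by
  have hterm : ∀ r s : ℕ, ((C a * X 1) ^ r * (C b * X 2) ^ s *
      ((p + q).choose r : MvPolynomial (Fin 3) K)) =
        monomial (exponent 0 r s) (a ^ r * b ^ s * ((p + q).choose r : K)) := by
    intro r s
    rw [← mul_one (_ * _ * _ : K), ← C_mul_monomial, ← X_pow_mul_X_pow_mul_X_pow]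
    simp only [map_mul, map_pow, map_natCast]
    ring
  rw [add_pow]
  simp only [hterm, coeff_sum, coeff_monomial, exponent_inj]
  rw [Finset.sum_eq_single p]
  · simp
  · intro r _ hr
    simp [hr]
  · simp

/-- If a combination of two `(n + 3)`-rd powers of independent linear forms in `y, z` has zero
`y ^ (n + 3)` and `y ^ (n + 2) * z` coefficients, then its `y ^ (n + 1) * z ^ 2` coefficient
also vanishes. -/
theorem coeff_two_powers_eq_zero {K : Type*} [Field K] [CharZero K] (n : ℕ)
    (c : Fin 2 → K) (ℓ : Fin 2 → MvPolynomial (Fin 3) K)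
    (hhom : ∀ i, (ℓ i).IsHomogeneous 1) (hyz : ∀ i, pderiv 0 (ℓ i) = 0)
    (hind : LinearIndependent K ℓ)
    (h0 : coeff (exponent 0 (n + 3) 0) (c 0 • ℓ 0 ^ (n + 3) + c 1 • ℓ 1 ^ (n + 3)) = 0)
    (h1 : coeff (exponent 0 (n + 2) 1) (c 0 • ℓ 0 ^ (n + 3) + c 1 • ℓ 1 ^ (n + 3)) = 0) :
    coeff (exponent 0 (n + 1) 2) (c 0 • ℓ 0 ^ (n + 3) + c 1 • ℓ 1 ^ (n + 3)) = 0 := by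
  obtain ⟨a, b, hab⟩ := exists_eq_of_isHomogeneous_one (hhom 0) (hyz 0)
  obtain ⟨a', b', hab'⟩ := exists_eq_of_isHomogeneous_one (hhom 1) (hyz 1)
  have hdet : a * b' - a' * b ≠ 0 := by
    intro hdet
    have hpair := Fintype.linearIndependent_iff.1 hind
    have hb := hpair ![b', -b] (by
      simp only [Fin.sum_univ_two, hab, hab', Matrix.cons_val_zero, Matrix.cons_val_one,
        smul_eq_C_mul, map_neg]
      have := congrArg (C : K → MvPolynomial (Fin 3) K) hdet
      simp only [map_sub, map_mul, map_zero] at this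
      linear_combination X 1 * this)
    have ha := hpair ![a', -a] (by
      simp only [Fin.sum_univ_two, hab, hab', Matrix.cons_val_zero, Matrix.cons_val_one,
        smul_eq_C_mul, map_neg]
      have := congrArg (C : K → MvPolynomial (Fin 3) K) hdet
      simp only [map_sub, map_mul, map_zero] at this
      linear_combination - X 2 * this)
    have ha0 : a = 0 := by simpa using ha 1
    have hb0 : b = 0 := by simpa using hb 1
    exact hind.ne_zero 0 (by simp [hab, ha0, hb0])
  have k0 := fun a b : K ↦ coeff_linear_form_pow a b (n + 3) 0
  have k1 := fun a b : K ↦ coeff_linear_form_pow a b (n + 2) 1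
  have k2 := fun a b : K ↦ coeff_linear_form_pow a b (n + 1) 2
  simp only [hab, hab', coeff_add, coeff_smul, smul_eq_mul, k2] at h0 h1 ⊢
  rw [k0, k0] at h0
  rw [k1, k1] at h1
  have hch : ((n + 2 + 1).choose (n + 2) : K) ≠ 0 :=
    Nat.cast_ne_zero.2 (Nat.choose_pos (by lia)).ne'
  have e0 : (c 0 * a ^ (n + 2)) * a + (c 1 * a' ^ (n + 2)) * a' = 0 := by
    simp only [add_zero, Nat.choose_self] at h0
    linear_combination h0
  have e1 : (c 0 * a ^ (n + 2)) * b + (c 1 * a' ^ (n + 2)) * b' = 0 := by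
    refine (mul_eq_zero.1 ?_).resolve_right hch
    linear_combination h1
  have u0 : c 0 * a ^ (n + 2) = 0 := by
    refine (mul_eq_zero.1 ?_).resolve_right hdet
    linear_combination b' * e0 - a' * e1
  have u1 : c 1 * a' ^ (n + 2) = 0 := by
    refine (mul_eq_zero.1 ?_).resolve_right hdet
    linear_combination a * e1 - b * e0
  have w0 : c 0 * a ^ (n + 1) = 0 := by
    rcases mul_eq_zero.1 u0 with h | h
    · simp [h]
    · simp [pow_eq_zero_iff (by lia : n + 2 ≠ 0) |>.1 h]
  have w1 : c 1 * a' ^ (n + 1) = 0 := by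
    rcases mul_eq_zero.1 u1 with h | h
    · simp [h]
    · simp [pow_eq_zero_iff (by lia : n + 2 ≠ 0) |>.1 h]
  linear_combination (b ^ 2 * ((n + 1 + 2).choose (n + 1) : K)) * w0 +
    (b' ^ 2 * ((n + 1 + 2).choose (n + 1) : K)) * w1

/-- If `H` is a linear combination of at most two `(2k+2)`-nd powers of pairwise
linearly independent linear forms in `y, z` and
`Fα = x·y^{k-1}·z^{k+2} + y^{2k}·z² − H`, then the span of the `(k+1)`-st order
partial derivatives of `Fα` has dimension at least `2k + 1`. -/
theorem hilbert_function_Falpha_middle (K : Type*) [Field K] [IsAlgClosed K] [CharZero K]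
    (k : ℕ) (hk : 1 ≤ k)
    (c : Fin 2 → K) (ℓ : Fin 2 → MvPolynomial (Fin 3) K)
    (hhom : ∀ i, (ℓ i).IsHomogeneous 1)
    (hyz : ∀ i, pderiv 0 (ℓ i) = 0)
    (hind : LinearIndependent K ℓ)
    (H : MvPolynomial (Fin 3) K)
    (hH : H = c 0 • ℓ 0 ^ (2 * k + 2) + c 1 • ℓ 1 ^ (2 * k + 2)) :
    2 * k + 1 ≤
      Module.finrank K
        (derivSpan K (k + 1)
          (X 0 * X 1 ^ (k - 1) * X 2 ^ (k + 2) + X 1 ^ (2 * k) * X 2 ^ 2 - H)) := by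
  have hn : 2 * k + 2 = (2 * k - 1) + 3 := by lia
  set G : MvPolynomial (Fin 3) K :=
    X 0 * X 1 ^ (k - 1) * X 2 ^ (k + 2) + X 1 ^ (2 * k) * X 2 ^ 2 - H with hG
  have hGmon : G = monomial (exponent 1 (k - 1) (k + 2)) 1 +
      monomial (exponent 0 (2 * k) 2) 1 - H := by
    rw [hG, ← X_pow_mul_X_pow_mul_X_pow, ← X_pow_mul_X_pow_mul_X_pow]
    simp
  have hH0 : pderiv 0 H = 0 := by
    rw [hH]
    simp [hyz]
  have hGx : ∀ i j l : ℕ, coeff (exponent (i + 1) j l) G =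
      if i = 0 ∧ j = k - 1 ∧ l = k + 2 then 1 else 0 := by
    intro i j l
    rw [hGmon, coeff_sub, coeff_add, coeff_monomial, coeff_monomial,
      coeff_eq_zero_of_pderiv_zero hH0]
    simp only [exponent_inj]
    rw [if_neg (by lia : ¬ (0 = i + 1 ∧ 2 * k = j ∧ 2 = l))]
    simp only [add_zero, sub_zero]
    congr 1
    apply propext
    lia
  have hR : ∃ j l s : ℕ, j + l = k + 1 ∧ k ≤ j ∧ s ≤ 1 ∧
      coeff (exponent 0 (k + 1 - s + j) (s + l)) G ≠ 0 := by
    by_contra! hcon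
    have h0 := hcon (k + 1) 0 0 (by lia) (by lia) (by lia)
    have h1 := hcon (k + 1) 0 1 (by lia) (by lia) (by lia)
    have h2 := hcon k 1 1 (by lia) (by lia) (by lia)
    rw [hGmon, coeff_sub, coeff_add, coeff_monomial, coeff_monomial] at h0 h1 h2
    simp only [exponent_inj] at h0 h1 h2
    rw [if_neg (by lia), if_neg (by lia)] at h0 h1
    rw [if_neg (by lia), if_pos (by lia)] at h2
    have hne := coeff_two_powers_eq_zero (2 * k - 1) c ℓ hhom hyz hind
    rw [← hn, ← hH] at hne
    have e0 : exponent 0 (k + 1 - 0 + (k + 1)) (0 + 0) = exponent 0 (2 * k + 2) 0 := by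
      congr 1; lia
    have e1 : exponent 0 (k + 1 - 1 + (k + 1)) (1 + 0) = exponent 0 (2 * k - 1 + 2) 1 := by
      congr 1; lia
    have e2 : exponent 0 (k + 1 - 1 + k) (1 + 1) = exponent 0 (2 * k - 1 + 1) 2 := by
      congr 1; lia
    rw [e0] at h0
    rw [e1] at h1
    rw [e2] at h2
    rw [hne (by simpa using h0) (by simpa using h1)] at h2
    simp at h2
  obtain ⟨a, b, s, hab, ha, hs, hGR⟩ := hR
  -- Derivatives with one `∂x`, those without `∂x` that still involve `x`, and one free of `x`.
  let v : Fin k ⊕ Fin k ⊕ Unit → MvPolynomial (Fin 3) K :=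
    Sum.elim (fun j ↦ iterPderiv K 1 j (k - j) G)
      (Sum.elim (fun j ↦ iterPderiv K 0 j (k + 1 - j) G) (fun _ ↦ iterPderiv K 0 a b G))
  let f : Fin k ⊕ Fin k ⊕ Unit → MvPolynomial (Fin 3) K →ₗ[K] K :=
    Sum.elim (fun j ↦ lcoeff K (exponent 0 (k - 1 - j) (2 + j)))
      (Sum.elim (fun j ↦ lcoeff K (exponent 1 (k - 1 - j) (1 + j)))
        (fun _ ↦ lcoeff K (exponent 0 (k + 1 - s) s)))
  let r : Fin k ⊕ Fin k ⊕ Unit → ℕ :=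
    Sum.elim (fun _ ↦ 2) (Sum.elim (fun _ ↦ 0) (fun _ ↦ 1))
  have hv : LinearIndependent K v := by
    refine linearIndependent_of_triangular v f r ?_ ?_
    · rintro (⟨j, hj⟩ | ⟨j, hj⟩ | _)
      · simp only [v, f, Sum.elim_inl, lcoeff_apply, ne_eq, coeff_iterPderiv_eq_zero_iff]
        rw [zero_add, ← zero_add 1, hGx, if_pos (by lia)]
        exact one_ne_zero
      · simp only [v, f, Sum.elim_inl, Sum.elim_inr, lcoeff_apply, ne_eq,
          coeff_iterPderiv_eq_zero_iff]
        rw [add_zero, ← zero_add 1, hGx, if_pos (by lia)]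
        exact one_ne_zero
      · simpa only [v, f, Sum.elim_inr, lcoeff_apply, ne_eq, coeff_iterPderiv_eq_zero_iff]
          using hGR
    · rintro (⟨i, hi⟩ | ⟨i, hi⟩ | _) (⟨j, hj⟩ | ⟨j, hj⟩ | _) hij hr <;>
        simp only [v, f, r, Sum.elim_inl, Sum.elim_inr, lcoeff_apply, ne_eq, Sum.inl.injEq,
          Sum.inr.injEq, Fin.mk.injEq, reduceCtorEq, not_false_eq_true, not_true_eq_false,
          coeff_iterPderiv_eq_zero_iff, zero_add, add_zero] at hij hr ⊢
      · rw [← zero_add 1, hGx, if_neg (by lia)]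
      · lia
      · lia
      · rw [hGx, if_neg (by lia)]
      · rw [← zero_add 1, hGx, if_neg (by lia)]
      · rw [← zero_add 1, hGx, if_neg (by lia)]
      · rw [← zero_add 1, hGx, if_neg (by lia)]
      · lia
  have hmem : ∀ t, v t ∈ derivSpan K (k + 1) G := by
    rintro (⟨j, hj⟩ | ⟨j, hj⟩ | _)
    · exact iterPderiv_mem_derivSpan (by lia) G
    · exact iterPderiv_mem_derivSpan (by lia) G
    · exact iterPderiv_mem_derivSpan (by lia) G
  have := finite_derivSpan (k + 1) G
  have hle := Submodule.finrank_mono (Submodule.span_le.2 (Set.range_subset_iff.2 hmem))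
  rw [finrank_span_eq_card hv] at hle
  simp only [Fintype.card_sum, Fintype.card_fin, Fintype.card_unit] at hle
  lia
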